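/- arXiv:math/0205039 — 2 statements merged into one kernel-verified Lean document; each statement's English description precedes it below -/
import Mathlib

section
/- Let φ : ℝ^{2n} → ℝ^{2n} be a C² diffeomorphism with Dφ(x) ∈ Sp(n, ℝ) for every x, and let F : ℝ^{2n} → ℝ be a C¹ function with DF(x)y = (1/2)ω(φ(x), Dφ(x)y) − (1/2)ω(x, y) for all x, y. Then the map f̃(x, x̄) = (φ(x), x̄ + F(x)) is a bijection of ℝ^{2n} × ℝ which preserves Lebesgue measure on ℝ^{2n+1}, is a group-theoretically compatible homeomorphism of H(n), and is Pansu differentiable at every point (x, x̄) with Pansu derivative the measure-preserving linear transformation (y, ȳ) ↦ (Dφ(x)y, ȳ). -/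
open MeasureTheory Set Function
open scoped BigOperators Topology

noncomputable section

/-- `ℝ^{2n}` with the Euclidean norm. -/
abbrev E (n : ℕ) := EuclideanSpace ℝ (Fin n ⊕ Fin n)

/-- The standard symplectic form `ω(x,y) = ⟨Jx, y⟩` on `ℝ^{2n}`. -/
def symp {n : ℕ} (x y : E n) : ℝ :=
  ∑ i : Fin n, (x (Sum.inl i) * y (Sum.inr i) - x (Sum.inr i) * y (Sum.inl i))

/-- The Heisenberg group `H(n) = ℝ^{2n} × ℝ` as a set. -/
abbrev Heis (n : ℕ) := E n × ℝ

/-- The Heisenberg group operation. -/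
def hmul {n : ℕ} (p q : Heis n) : Heis n :=
  (p.1 + q.1, p.2 + q.2 + (1/2) * symp p.1 q.1)

/-- The group inverse in `H(n)`. -/
def hinv {n : ℕ} (p : Heis n) : Heis n := (-p.1, -p.2)

/-- The dilation `δ_ε(x, x̄) = (εx, ε²x̄)`. -/
def dil {n : ℕ} (ε : ℝ) (p : Heis n) : Heis n := (ε • p.1, ε^2 * p.2)

/-- A linear transformation of `H(n)`: a group endomorphism commuting with all
dilations. -/
def IsLinearHeis {n : ℕ} (L : Heis n → Heis n) : Prop :=
  (∀ p q : Heis n, L (hmul p q) = hmul (L p) (L q)) ∧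
  (∀ ε : ℝ, 0 < ε → L ∘ dil ε = dil ε ∘ L)

/-- `f` is Pansu differentiable at `p` with Pansu derivative `L`. -/
def PansuDiffAt {n : ℕ} (f : Heis n → Heis n) (p : Heis n) (L : Heis n → Heis n) :
    Prop :=
  IsLinearHeis L ∧
  TendstoUniformlyOn
    (fun (ε : ℝ) (w : Heis n) => dil ε⁻¹ (hmul (hinv (f p)) (f (hmul p (dil ε w)))))
    L (𝓝[>] 0) (Metric.closedBall 0 1)

/-- The symplectic form as a continuous bilinear map. -/
def sympCLM (n : ℕ) : E n →L[ℝ] E n →L[ℝ] ℝ :=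
  LinearMap.toContinuousBilinearMap <| LinearMap.mk₂ ℝ (symp (n := n))
    (fun x x' y => by
      simp only [symp, PiLp.add_apply, ← Finset.sum_add_distrib]
      exact Finset.sum_congr rfl fun _ _ => by ring)
    (fun c x y => by
      simp only [symp, PiLp.smul_apply, smul_eq_mul, Finset.mul_sum]
      exact Finset.sum_congr rfl fun _ _ => by ring)
    (fun x y y' => by
      simp only [symp, PiLp.add_apply, ← Finset.sum_add_distrib]
      exact Finset.sum_congr rfl fun _ _ => by ring)
    (fun c x y => by
      simp only [symp, PiLp.smul_apply, smul_eq_mul, Finset.mul_sum]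
      exact Finset.sum_congr rfl fun _ _ => by ring)

theorem symp_eq_sympCLM {n : ℕ} (x y : E n) : symp x y = sympCLM n x y := rfl

theorem symp_self {n : ℕ} (x : E n) : symp x x = 0 :=
  Finset.sum_eq_zero fun _ _ => by ring

theorem symp_eq_dotProduct_J {n : ℕ} (x y : E n) :
    symp x y = -(x.ofLp ⬝ᵥ (Matrix.J (Fin n) ℝ).mulVec y.ofLp) := by
  simp only [symp, Matrix.J, Matrix.fromBlocks_mulVec, dotProduct, Fintype.sum_sum_type,
    Sum.elim_inl, Sum.elim_inr, Matrix.zero_mulVec, Matrix.neg_mulVec, Matrix.one_mulVec,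
    zero_add, add_zero, Pi.neg_apply, Function.comp_apply, ← Finset.sum_neg_distrib,
    ← Finset.sum_add_distrib]
  exact Finset.sum_congr rfl fun _ _ => by ring

theorem abs_det_eq_one_of_symp {n : ℕ} (A : E n →L[ℝ] E n)
    (hA : ∀ y z, symp (A y) (A z) = symp y z) : |A.det| = 1 := by
  set b := (EuclideanSpace.basisFun (Fin n ⊕ Fin n) ℝ).toBasis
  set M := LinearMap.toMatrix b b (A : E n →ₗ[ℝ] E n)
  have hMv : ∀ y : E n, (A y).ofLp = M.mulVec y.ofLp := fun y =>
    (LinearMap.toMatrix_mulVec_repr b b (A : E n →ₗ[ℝ] E n) y).symm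
  have hJ : M.transpose * Matrix.J (Fin n) ℝ * M = Matrix.J (Fin n) ℝ := by
    refine Matrix.ext_of_mulVec_single fun i => ?_
    refine dotProduct_eq _ _ fun v => ?_
    have h := hA (WithLp.toLp 2 v) (WithLp.toLp 2 (Pi.single i 1))
    simp only [symp_eq_dotProduct_J, hMv, neg_inj] at h
    rw [dotProduct_comm, dotProduct_comm _ v, ← h, Matrix.mul_assoc, ← Matrix.mulVec_mulVec,
      ← Matrix.mulVec_mulVec, Matrix.dotProduct_mulVec, Matrix.vecMul_transpose]
  have hdet : A.det = M.det := (LinearMap.det_toMatrix b (A : E n →ₗ[ℝ] E n)).symm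
  have h := congrArg Matrix.det hJ
  rw [Matrix.det_mul, Matrix.det_mul, Matrix.det_transpose] at h
  have hu := (Matrix.isUnit_det_J (Fin n) ℝ).ne_zero
  have hsq : M.det ^ 2 = 1 := mul_right_cancel₀ hu (by linear_combination h)
  rw [hdet]
  exact (sq_eq_sq₀ (abs_nonneg _) zero_le_one).1 (by rw [sq_abs, hsq, one_pow])

theorem measurePreserving_of_abs_det_fderiv_eq_one {V : Type*} [NormedAddCommGroup V]
    [NormedSpace ℝ V] [FiniteDimensional ℝ V] [MeasurableSpace V] [BorelSpace V]
    (μ : Measure V) [μ.IsAddHaarMeasure] {f : V → V} {f' : V → V →L[ℝ] V}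
    (hf : ∀ x, HasFDerivAt f (f' x) x) (hbij : Bijective f) (hdet : ∀ x, |(f' x).det| = 1) :
    MeasurePreserving f μ μ := by
  have hm : Measurable f :=
    (continuous_iff_continuousAt.2 fun x => (hf x).continuousAt).measurable
  refine ⟨hm, Measure.ext fun s hs => ?_⟩
  have h := lintegral_abs_det_fderiv_eq_addHaar_image μ (hm hs)
    (fun x _ => (hf x).hasFDerivWithinAt) hbij.injective.injOn
  rw [Measure.map_apply hm hs]
  simpa [hdet, image_preimage_eq s hbij.surjective] using h

theorem measurePreserving_prod_add {V : Type*} [MeasureSpace V] [SFinite (volume : Measure V)]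
    {f : V → V} (hf : MeasurePreserving f volume volume) {g : V → ℝ} (hg : Measurable g) :
    MeasurePreserving (fun p : V × ℝ => (f p.1, p.2 + g p.1)) volume volume :=
  hf.skew_product (g := fun x t => t + g x) (by fun_prop)
    (Filter.Eventually.of_forall fun x => map_add_right_eq_self volume (g x))

theorem norm_le_of_norm_fderiv_le_mul_norm {V : Type*} [NormedAddCommGroup V] [NormedSpace ℝ V]
    {G : V → ℝ} {G' : V → V →L[ℝ] ℝ} (hG : ∀ y, HasFDerivAt G (G' y) y) (hG0 : G 0 = 0)
    {c : ℝ} (hc : 0 ≤ c) {y : V} (h : ∀ z, ‖z‖ ≤ ‖y‖ → ‖G' z‖ ≤ c * ‖z‖) :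
    ‖G y‖ ≤ c * ‖y‖ ^ 2 := by
  have := (convex_closedBall (0 : V) ‖y‖).norm_image_sub_le_of_norm_hasFDerivWithin_le
    (f := G) (f' := G') (C := c * ‖y‖) (x := 0) (y := y)
    (fun z _ => (hG z).hasFDerivWithinAt)
    (fun z hz => by
      have hz' : ‖z‖ ≤ ‖y‖ := by simpa using hz
      exact (h z hz').trans (by gcongr))
    (by simp) (by simp)
  simpa [hG0, pow_two, mul_assoc] using this

open Asymptotics in
theorem isLittleO_sq_of_fderiv_isLittleO {V : Type*} [NormedAddCommGroup V] [NormedSpace ℝ V]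
    {G : V → ℝ} {G' : V → V →L[ℝ] ℝ} (hG : ∀ y, HasFDerivAt G (G' y) y) (hG0 : G 0 = 0)
    (h : G' =o[𝓝 0] fun y => y) : G =o[𝓝 0] fun y => ‖y‖ ^ 2 := by
  refine isLittleO_iff.2 fun c hc => ?_
  obtain ⟨δ, hδ, hball⟩ := Metric.eventually_nhds_iff_ball.1 (isLittleO_iff.1 h hc)
  filter_upwards [Metric.ball_mem_nhds (0 : V) hδ] with y hy
  rw [norm_pow, norm_norm]
  refine norm_le_of_norm_fderiv_le_mul_norm hG hG0 hc.le fun z hz => hball z ?_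
  rw [mem_ball_zero_iff] at hy ⊢
  exact hz.trans_lt hy

open Asymptotics in
/-- The vertical displacement of the lift vanishes to higher than second order. -/
theorem vertical_remainder_isLittleO {n : ℕ} {φ : E n → E n} {F : E n → ℝ}
    (hφ : ContDiff ℝ 1 φ) (hF : Differentiable ℝ F)
    (hsymp : ∀ x y z : E n, symp (fderiv ℝ φ x y) (fderiv ℝ φ x z) = symp y z)
    (hgen : ∀ x y : E n,
      fderiv ℝ F x y = (1/2) * symp (φ x) (fderiv ℝ φ x y) - (1/2) * symp x y) (x : E n) :
    (fun y => (1/2) * symp x y + (F (x + y) - F x) - (1/2) * symp (φ x) (φ (x + y)))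
      =o[𝓝 0] fun y => ‖y‖ ^ 2 := by
  set B := sympCLM n
  set A := fderiv ℝ φ
  have hφd : ∀ y, HasFDerivAt (fun y => φ (x + y)) (A (x + y)) y := fun y =>
    (hφ.differentiable one_ne_zero (x + y)).hasFDerivAt.comp y ((hasFDerivAt_id y).const_add x)
  have hFd : ∀ y, HasFDerivAt (fun y => F (x + y)) (fderiv ℝ F (x + y)) y := fun y =>
    (hF (x + y)).hasFDerivAt.comp y ((hasFDerivAt_id y).const_add x)
  have hr : (fun y => φ (x + y) - φ x - A x y) =o[𝓝 0] fun y => y :=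
    hasFDerivAt_iff_isLittleO_nhds_zero.1 (hφ.differentiable one_ne_zero x).hasFDerivAt
  have hAc : Filter.Tendsto (fun y => A (x + y)) (𝓝 0) (𝓝 (A x)) := by
    have : Continuous fun y => A (x + y) :=
      (hφ.continuous_fderiv one_ne_zero).comp (continuous_const.add continuous_id)
    simpa using this.tendsto 0
  refine isLittleO_sq_of_fderiv_isLittleO
    (G' := fun y => (1/2 : ℝ) • ((B (φ (x + y) - φ x - A x y)).comp (A (x + y)) +
      (B (A x y)).comp (A (x + y) - A x))) (fun y => ?_) ?_ ?_
  · have h1 := ((B x).hasFDerivAt (x := y)).const_mul (1/2 : ℝ)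
    have h2 := (((B (φ x)).hasFDerivAt (x := φ (x + y))).comp y (hφd y)).const_mul (1/2 : ℝ)
    refine ((h1.add ((hFd y).sub_const (F x))).sub h2).congr_fderiv ?_
    ext v
    have hs : B (A x y) (A x v) = B y v := hsymp x y v
    have hg : fderiv ℝ F (x + y) v
      = (1/2) * B (φ (x + y)) (A (x + y) v) - (1/2) * B (x + y) v := hgen (x + y) v
    simp [hg]
    linear_combination (1/2) * hs
  · simp [symp_self, symp_eq_sympCLM]
  · have h1 : (fun y => (B (φ (x + y) - φ x - A x y)).comp (A (x + y))) =o[𝓝 0] fun y => y := by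
      have hb : (fun y => B (φ (x + y) - φ x - A x y)) =o[𝓝 0] fun y => ‖y‖ :=
        (B.isBigO_comp _ _).trans_isLittleO hr.norm_right
      have := hb.norm_left.mul_isBigO (hAc.isBigO_one ℝ).norm_left
      simp only [mul_one] at this
      exact (IsBigO.of_norm_le fun y => ContinuousLinearMap.opNorm_comp_le _ _).trans_isLittleO
        this.of_norm_right
    have h2 : (fun y => (B (A x y)).comp (A (x + y) - A x)) =o[𝓝 0] fun y => y := by
      have hb : (fun y => B (A x y)) =O[𝓝 0] fun y => ‖y‖ :=
        ((B.isBigO_comp _ _).trans ((A x).isBigO_id _)).norm_right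
      have hd : (fun y => A (x + y) - A x) =o[𝓝 0] fun _ => (1 : ℝ) :=
        (isLittleO_one_iff ℝ).2 (by simpa using hAc.sub_const (A x))
      have := hb.norm_left.mul_isLittleO hd.norm_left
      simp only [mul_one] at this
      exact (IsBigO.of_norm_le fun y => ContinuousLinearMap.opNorm_comp_le _ _).trans_isLittleO
        this.of_norm_right
    exact (h1.add h2).const_smul_left (1/2 : ℝ)

theorem isLinearHeis_of_symp {n : ℕ} (A : E n →L[ℝ] E n)
    (hA : ∀ y z, symp (A y) (A z) = symp y z) :
    IsLinearHeis fun w : Heis n => ((A w.1, w.2) : Heis n) := by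
  refine ⟨fun p q => ?_, fun ε _ => ?_⟩
  · simp [hmul, hA]
  · ext1 w
    simp [dil]

/-- The rescaled increment of the lift differs from `(Dφ(x)y, ȳ)` by rescaled remainders. -/
theorem dil_increment_sub {n : ℕ} {φ : E n → E n} {F : E n → ℝ} (A : E n →L[ℝ] E n)
    (p w : Heis n) {ε : ℝ} (hε : ε ≠ 0) :
    dil ε⁻¹ (hmul (hinv (φ p.1, p.2 + F p.1))
        (φ (hmul p (dil ε w)).1, (hmul p (dil ε w)).2 + F (hmul p (dil ε w)).1)) - (A w.1, w.2) =
      (ε⁻¹ • (φ (p.1 + ε • w.1) - φ p.1 - A (ε • w.1)),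
        ε⁻¹ ^ 2 * ((1/2) * symp p.1 (ε • w.1) + (F (p.1 + ε • w.1) - F p.1)
          - (1/2) * symp (φ p.1) (φ (p.1 + ε • w.1)))) := by
  refine Prod.ext ?_ ?_
  · simp only [dil, hmul, hinv, Prod.fst_sub, map_smul, smul_sub, smul_add, smul_neg,
      inv_smul_smul₀ hε]
    abel
  · simp only [dil, hmul, hinv, Prod.snd_sub, symp_eq_sympCLM, map_neg,
      neg_apply]
    field_simp
    ring

theorem pansuDiffAt_lift {n : ℕ} {φ : E n → E n} {F : E n → ℝ}
    (hφ : ContDiff ℝ 1 φ) (hF : Differentiable ℝ F)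
    (hsymp : ∀ x y z : E n, symp (fderiv ℝ φ x y) (fderiv ℝ φ x z) = symp y z)
    (hgen : ∀ x y : E n,
      fderiv ℝ F x y = (1/2) * symp (φ x) (fderiv ℝ φ x y) - (1/2) * symp x y) (p : Heis n) :
    PansuDiffAt (fun q : Heis n => ((φ q.1, q.2 + F q.1) : Heis n)) p
      (fun w : Heis n => ((fderiv ℝ φ p.1 w.1, w.2) : Heis n)) := by
  refine ⟨isLinearHeis_of_symp _ (hsymp p.1), Metric.tendstoUniformlyOn_iff.2 fun η hη => ?_⟩
  have hr := hasFDerivAt_iff_isLittleO_nhds_zero.1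
    (hφ.differentiable one_ne_zero p.1).hasFDerivAt
  have hG := vertical_remainder_isLittleO hφ hF hsymp hgen p.1
  obtain ⟨δ, hδ, hball⟩ := Metric.eventually_nhds_iff_ball.1
    ((Asymptotics.isLittleO_iff.1 hr (half_pos hη)).and
      (Asymptotics.isLittleO_iff.1 hG (half_pos hη)))
  filter_upwards [Ioo_mem_nhdsGT hδ] with ε hε w hw
  have hε0 : 0 < ε := hε.1
  have hw1 : ‖w.1‖ ≤ 1 := (norm_fst_le w).trans (mem_closedBall_zero_iff.1 hw)
  have hle : ‖ε • w.1‖ ≤ ε := by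
    rw [norm_smul, Real.norm_of_nonneg hε0.le]
    exact mul_le_of_le_one_right hε0.le hw1
  obtain ⟨h1, h2⟩ := hball (ε • w.1) (mem_ball_zero_iff.2 (hle.trans_lt hε.2))
  rw [dist_comm, dist_eq_norm, dil_increment_sub _ p w hε0.ne']
  refine lt_of_le_of_lt ?_ (half_lt_self hη)
  rw [norm_pow, norm_norm] at h2
  refine norm_prod_le_iff.2 ⟨?_, ?_⟩
  · rw [norm_smul, norm_inv, Real.norm_of_nonneg hε0.le, inv_mul_le_iff₀ hε0, mul_comm ε]
    exact h1.trans (by gcongr)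
  · rw [norm_mul, norm_pow, norm_inv, Real.norm_of_nonneg hε0.le, inv_pow,
      inv_mul_le_iff₀ (by positivity), mul_comm (ε ^ 2)]
    exact h2.trans (by gcongr)

/-- If `φ` is a `C²` symplectomorphism of `ℝ^{2n}` and `F` a `C¹` generating function
of `φ`, then `f̃(x, x̄) = (φ(x), x̄ + F(x))` is a measure preserving bijective
homeomorphism of `H(n)`, Pansu differentiable at every point with measure
preserving linear Pansu derivative `(y, ȳ) ↦ (Dφ(x)y, ȳ)`. -/
theorem lift_of_symplectomorphism_is_volume_preserving
    (n : ℕ) (φ ψ : E n → E n) (F : E n → ℝ)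
    (hφ : ContDiff ℝ 2 φ) (hψ : ContDiff ℝ 2 ψ)
    (hψl : Function.LeftInverse ψ φ) (hψr : Function.RightInverse ψ φ)
    (hsymp : ∀ (x y z : E n), symp (fderiv ℝ φ x y) (fderiv ℝ φ x z) = symp y z)
    (hF : ContDiff ℝ 1 F)
    (hgen : ∀ (x y : E n),
      fderiv ℝ F x y = (1/2) * symp (φ x) (fderiv ℝ φ x y) - (1/2) * symp x y) :
    Function.Bijective (fun p : Heis n => ((φ p.1, p.2 + F p.1) : Heis n)) ∧
    MeasurePreserving (fun p : Heis n => ((φ p.1, p.2 + F p.1) : Heis n))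
      volume volume ∧
    IsHomeomorph (fun p : Heis n => ((φ p.1, p.2 + F p.1) : Heis n)) ∧
    (∀ p : Heis n,
      PansuDiffAt (fun q : Heis n => ((φ q.1, q.2 + F q.1) : Heis n)) p
        (fun w : Heis n => ((fderiv ℝ φ p.1 w.1, w.2) : Heis n)) ∧
      MeasurePreserving (fun w : Heis n => ((fderiv ℝ φ p.1 w.1, w.2) : Heis n))
        volume volume) := by
  have hφ1 : ContDiff ℝ 1 φ := hφ.of_le one_le_two
  have hdet x : |(fderiv ℝ φ x).det| = 1 := abs_det_eq_one_of_symp _ (hsymp x)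
  let e : Heis n ≃ₜ Heis n :=
    { toFun := fun p => (φ p.1, p.2 + F p.1)
      invFun := fun p => (ψ p.1, p.2 - F (ψ p.1))
      left_inv := fun p => by simp [hψl p.1]
      right_inv := fun p => by simp [hψr p.1]
      continuous_toFun := by
        have := hφ.continuous
        have := hF.continuous
        fun_prop
      continuous_invFun := by
        have := hψ.continuous
        have := hF.continuous
        fun_prop }
  refine ⟨e.bijective, ?_, e.isHomeomorph, fun p =>
    ⟨pansuDiffAt_lift hφ1 (hF.differentiable one_ne_zero) hsymp hgen p, ?_⟩⟩
  · exact measurePreserving_prod_add (measurePreserving_of_abs_det_fderiv_eq_one volume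
      (fun x => (hφ1.differentiable one_ne_zero x).hasFDerivAt)
      ⟨hψl.injective, hψr.surjective⟩ hdet) hF.continuous.measurable
  · have hne : LinearMap.det (fderiv ℝ φ p.1 : E n →ₗ[ℝ] E n) ≠ 0 :=
      abs_ne_zero.1 ((hdet p.1).trans_ne one_ne_zero)
    have hbij : Bijective (fderiv ℝ φ p.1) :=
      (LinearMap.equivOfDetNeZero (fderiv ℝ φ p.1 : E n →ₗ[ℝ] E n) hne).bijective
    simpa using measurePreserving_prod_add (measurePreserving_of_abs_det_fderiv_eq_one volume
      (fun x => (fderiv ℝ φ p.1).hasFDerivAt (x := x)) hbij fun _ => hdet p.1)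
      (measurable_const (a := (0 : ℝ)))
end
end

section
/- Let φ̃(x, x̄) = (φ(x), x̄ + F(x)) be a homeomorphism of ℝ^{2n} × ℝ which preserves Lebesgue measure on ℝ^{2n+1} and is locally bi-Lipschitz with respect to the Carnot–Carathéodory distance d_CC on H(n) (i.e. φ̃ and φ̃^{-1} are locally Lipschitz from (H(n), d_CC) to itself). Then φ : ℝ^{2n} → ℝ^{2n} and F : ℝ^{2n} → ℝ are locally Lipschitz for the Euclidean distance, and for almost every x ∈ ℝ^{2n}: φ and F are differentiable at x, Dφ(x) ∈ Sp(n, ℝ), and DF(x)y = (1/2)ω(φ(x), Dφ(x)y) − (1/2)ω(x, y) for all y ∈ ℝ^{2n}. -/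
open MeasureTheory Set Function
open scoped BigOperators Topology NNReal

noncomputable section

/-- The a.e. horizontality condition on `[0,1]` for a curve `(c, cb)` in `H(n)`. -/
def HorizOn {n : ℕ} (c : ℝ → E n) (cb : ℝ → ℝ) : Prop :=
  ∀ᵐ t ∂(volume.restrict (Icc (0:ℝ) 1)),
    HasDerivAt cb ((1/2) * symp (c t) (deriv c t)) t

/-- The Carnot–Carathéodory distance on `H(n)`: the infimum of Euclidean lengths of
horizontal Lipschitz curves joining two points. -/
def ccDist {n : ℕ} (p q : Heis n) : ℝ :=
  sInf { L : ℝ | ∃ (c : ℝ → E n) (cb : ℝ → ℝ) (K K' : ℝ≥0),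
    LipschitzWith K c ∧ LipschitzWith K' cb ∧
    c 0 = p.1 ∧ cb 0 = p.2 ∧ c 1 = q.1 ∧ cb 1 = q.2 ∧
    HorizOn c cb ∧
    L = ∫ t in Icc (0:ℝ) 1, ‖deriv c t‖ }

/-- Local Lipschitz continuity of a map with respect to given distance functions. -/
def LocLipWith {X Y : Type*} (dX : X → X → ℝ) (dY : Y → Y → ℝ) (f : X → Y) : Prop :=
  ∀ p : X, ∃ r : ℝ, 0 < r ∧ ∃ K : ℝ, 0 ≤ K ∧
    ∀ q q' : X, dX p q < r → dX p q' < r → dY (f q) (f q') ≤ K * dX q q'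

/-- The symplectic form as a continuous bilinear map. -/
def sympL (n : ℕ) : E n →L[ℝ] E n →L[ℝ] ℝ :=
  LinearMap.toContinuousLinearMap
    ((LinearMap.toContinuousLinearMap : (E n →ₗ[ℝ] ℝ) ≃ₗ[ℝ] (E n →L[ℝ] ℝ)).toLinearMap ∘ₗ
      LinearMap.mk₂ ℝ (symp (n := n))
        (fun x y z => by
          simp only [symp, PiLp.add_apply, ← Finset.sum_add_distrib]
          exact Finset.sum_congr rfl fun i _ => by ring)
        (fun a x y => by
          simp only [symp, PiLp.smul_apply, smul_eq_mul, Finset.mul_sum]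
          exact Finset.sum_congr rfl fun i _ => by ring)
        (fun x y z => by
          simp only [symp, PiLp.add_apply, ← Finset.sum_add_distrib]
          exact Finset.sum_congr rfl fun i _ => by ring)
        (fun a x y => by
          simp only [symp, PiLp.smul_apply, smul_eq_mul, Finset.mul_sum]
          exact Finset.sum_congr rfl fun i _ => by ring))

lemma symp_eq_sympL {n : ℕ} (x y : E n) : symp x y = sympL n x y := rfl

lemma sympL_swap {n : ℕ} (x y : E n) : sympL n x y = -sympL n y x := by
  simp only [← symp_eq_sympL, symp, ← Finset.sum_neg_distrib]
  exact Finset.sum_congr rfl fun i _ => by ring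

lemma sympL_self {n : ℕ} (x : E n) : sympL n x x = 0 := by
  linarith [sympL_swap x x]

lemma abs_sympL_le {n : ℕ} (x y : E n) : |sympL n x y| ≤ ‖sympL n‖ * ‖x‖ * ‖y‖ := by
  simpa using (sympL n).le_opNorm₂ x y

lemma exists_sympL_eq_one {n : ℕ} (hn : 1 ≤ n) : ∃ e f : E n, sympL n e f = 1 := by
  refine ⟨EuclideanSpace.single (Sum.inl ⟨0, hn⟩) 1, EuclideanSpace.single (Sum.inr ⟨0, hn⟩) 1, ?_⟩
  rw [← symp_eq_sympL, symp, Finset.sum_eq_single ⟨0, hn⟩] <;>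
    simp +contextual

lemma hasFDerivAt_of_quadratic_bound {V : Type*} [NormedAddCommGroup V] [NormedSpace ℝ V]
    {f : V → ℝ} {ℓ : V →L[ℝ] ℝ} {x : V} {C : ℝ}
    (h : ∀ᶠ y in 𝓝 x, |f y - f x - ℓ (y - x)| ≤ C * ‖y - x‖ ^ 2) : HasFDerivAt f ℓ x := by
  rw [hasFDerivAt_iff_isLittleO]
  refine Asymptotics.IsBigO.trans_isLittleO (g := fun y => ‖y - x‖ ^ 2) ?_
    (Asymptotics.isLittleO_pow_sub_sub x one_lt_two)
  refine Asymptotics.IsBigO.of_bound C ?_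
  filter_upwards [h] with y hy
  simpa using hy

/-- If `dF = ½ω(φ, dφ) - ½ω(x, dx)` up to quadratic errors, uniformly near `x`, then the
derivative of `φ` at `x` is symplectic: the blow-ups of `F` at `x` converge to a function whose
second derivative is the skew form `½(A^*ω - ω)`. -/
lemma symplectic_of_quadratic_bound {n : ℕ} {φ : E n → E n} {F : E n → ℝ} {x : E n} {C δ : ℝ}
    (hδ : 0 < δ)
    (hF : ∀ y ∈ Metric.ball x δ, ∀ z ∈ Metric.ball x δ,
      |F z - F y - (1/2) * sympL n (φ y) (φ z) + (1/2) * sympL n y z| ≤ C * ‖z - y‖ ^ 2)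
    {A : E n →L[ℝ] E n} (hA : HasFDerivAt φ A x) (u v : E n) :
    sympL n (A u) (A v) = sympL n u v := by
  let Φ : ℝ → E n → E n := fun h q => h⁻¹ • (φ (x + h • q) - φ x)
  let G : ℝ → E n → ℝ := fun h q => (h⁻¹) ^ 2 * (F (x + h • q) - F x
    - (1/2) * sympL n (φ x) (φ (x + h • q)) + (1/2) * sympL n x (x + h • q))
  let U : Ultrafilter ℝ := Ultrafilter.of (𝓝[>] (0:ℝ))
  have hU : (U : Filter ℝ) ≤ 𝓝[>] (0:ℝ) := Ultrafilter.of_le _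
  have hΦ (q : E n) : Filter.Tendsto (fun h => Φ h q) U (𝓝 (A q)) := by
    have h1 : HasDerivAt (fun h : ℝ => φ (x + h • q)) (A q) 0 := by
      have h2 : HasDerivAt (fun h : ℝ => x + h • q) q 0 := by
        simpa using ((hasDerivAt_id (0:ℝ)).smul_const q).const_add x
      have h3 : HasFDerivAt φ A (x + (0:ℝ) • q) := by simpa using hA
      exact h3.comp_hasDerivAt 0 h2
    have h4 := hasDerivAt_iff_tendsto_slope.1 h1
    refine Filter.Tendsto.mono_left (Filter.Tendsto.congr (fun h => ?_) h4) (hU.trans ?_)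
    · simp [slope, Φ]
    · exact nhdsWithin_mono _ fun h hh => ne_of_gt hh
  have hball (q : E n) : ∀ᶠ h in (U : Filter ℝ), x + h • q ∈ Metric.ball x δ := by
    have h2 : Filter.Tendsto (fun h : ℝ => x + h • q) (𝓝 0) (𝓝 x) := by
      have : Continuous (fun h : ℝ => x + h • q) := by fun_prop
      simpa using this.tendsto 0
    exact (hU.trans nhdsWithin_le_nhds) (h2 (Metric.ball_mem_nhds x hδ))
  have hpos : ∀ᶠ h in (U : Filter ℝ), 0 < h := hU self_mem_nhdsWithin
  have hG (p q : E n) : ∀ᶠ h in (U : Filter ℝ),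
      |G h q - G h p - (1/2) * sympL n (Φ h p) (Φ h q) + (1/2) * sympL n p q|
        ≤ C * ‖q - p‖ ^ 2 := by
    filter_upwards [hpos, hball p, hball q] with h h0 hp hq
    have key := hF _ hp _ hq
    have e1 : x + h • q - (x + h • p) = h • (q - p) := by rw [smul_sub]; abel
    rw [e1, norm_smul, Real.norm_of_nonneg h0.le] at key
    have e2 : G h q - G h p - (1/2) * sympL n (Φ h p) (Φ h q) + (1/2) * sympL n p q
        = (h⁻¹) ^ 2 * (F (x + h • q) - F (x + h • p)
          - (1/2) * sympL n (φ (x + h • p)) (φ (x + h • q))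
          + (1/2) * sympL n (x + h • p) (x + h • q)) := by
      have s1 := sympL_swap (φ (x + h • p)) (φ x)
      have s2 := sympL_swap p x
      have s3 := sympL_self x
      have s4 := sympL_self (φ x)
      simp only [G, Φ, map_smul, map_sub, map_add, smul_eq_mul,
        add_apply, sub_apply,
        smul_apply, s1, s2, s3, s4]
      field_simp
      ring
    rw [e2, abs_mul, abs_of_nonneg (by positivity)]
    calc _ ≤ (h⁻¹) ^ 2 * (C * (h * ‖q - p‖) ^ 2) := by gcongr
      _ = _ := by field_simp
  have hlim (q : E n) : ∃ g : ℝ, Filter.Tendsto (fun h => G h q) U (𝓝 g) := by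
    have hb : ∀ᶠ h in (U : Filter ℝ), G h q ∈ Icc (-(C * ‖q‖ ^ 2)) (C * ‖q‖ ^ 2) := by
      filter_upwards [hG 0 q] with h hh
      have e : G h 0 = 0 := by simp [G, sympL_self]
      have : |G h q| ≤ C * ‖q‖ ^ 2 := by simpa [Φ, e] using hh
      exact abs_le.mp this
    obtain ⟨g, -, hg⟩ := (isCompact_Icc (a := -(C * ‖q‖ ^ 2)) (b := C * ‖q‖ ^ 2)).ultrafilter_le_nhds
      (U.map fun h => G h q) (Filter.le_principal_iff.2 hb)
    exact ⟨g, hg⟩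
  choose g hg using hlim
  let B : E n →L[ℝ] E n →L[ℝ] ℝ :=
    (1/2 : ℝ) • (sympL n).bilinearComp A A - (1/2 : ℝ) • sympL n
  have hB (p q : E n) : B p q = (1/2) * sympL n (A p) (A q) - (1/2) * sympL n p q := by
    simp [B]
  have hgB (p q : E n) : |g q - g p - B p (q - p)| ≤ C * ‖q - p‖ ^ 2 := by
    have ht : Filter.Tendsto (fun h => |G h q - G h p - (1/2) * sympL n (Φ h p) (Φ h q)
        + (1/2) * sympL n p q|) U
        (𝓝 |g q - g p - (1/2) * sympL n (A p) (A q) + (1/2) * sympL n p q|) := by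
      have hcΦ : Filter.Tendsto (fun h => sympL n (Φ h p) (Φ h q)) U
          (𝓝 (sympL n (A p) (A q))) := by
        have hpair : Filter.Tendsto (fun h => (Φ h p, Φ h q)) U (𝓝 (A p, A q)) :=
          (hΦ p).prodMk_nhds (hΦ q)
        have hcomp := ((sympL n).continuous₂.tendsto (A p, A q)).comp hpair
        exact hcomp
      exact ((((hg q).sub (hg p)).sub (hcΦ.const_mul (1/2))).add_const _).abs
    have := le_of_tendsto ht (hG p q)
    rwa [hB, show g q - g p - ((1/2) * sympL n (A p) (A (q - p)) - (1/2) * sympL n p (q - p))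
      = g q - g p - (1/2) * sympL n (A p) (A q) + (1/2) * sympL n p q by
        simp only [map_sub, sympL_self]; ring]
  have hsymm := second_derivative_symmetric (f := g) (f' := B) (x := 0)
    (fun p => hasFDerivAt_of_quadratic_bound (Filter.Eventually.of_forall (hgB p)))
    B.hasFDerivAt u v
  rw [hB, hB] at hsymm
  linarith [sympL_swap (A u) (A v), sympL_swap u v]

/-- The lengths of the horizontal Lipschitz curves joining `p` to `q`. -/
def horizLengths {n : ℕ} (p q : Heis n) : Set ℝ :=
  { L : ℝ | ∃ (c : ℝ → E n) (cb : ℝ → ℝ) (K K' : ℝ≥0),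
    LipschitzWith K c ∧ LipschitzWith K' cb ∧
    c 0 = p.1 ∧ cb 0 = p.2 ∧ c 1 = q.1 ∧ cb 1 = q.2 ∧
    HorizOn c cb ∧
    L = ∫ t in Icc (0:ℝ) 1, ‖deriv c t‖ }

lemma horizLengths_nonneg {n : ℕ} {p q : Heis n} {L : ℝ} (hL : L ∈ horizLengths p q) :
    0 ≤ L := by
  obtain ⟨c, cb, K, K', -, -, -, -, -, -, -, rfl⟩ := hL
  exact integral_nonneg fun t => norm_nonneg _

lemma integrableOn_norm_deriv {V : Type*} [NormedAddCommGroup V] [NormedSpace ℝ V]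
    [FiniteDimensional ℝ V] {c : ℝ → V} {K : ℝ≥0} (hc : LipschitzWith K c) :
    IntegrableOn (fun t => ‖deriv c t‖) (Icc (0:ℝ) 1) := by
  have := FiniteDimensional.complete ℝ V
  borelize V
  refine Measure.integrableOn_of_bounded (M := K) (by simp)
    (measurable_deriv c).norm.aestronglyMeasurable (Filter.Eventually.of_forall fun t => ?_)
  simpa using norm_deriv_le_of_lipschitz hc

/-- A Lipschitz function whose derivative is a.e. bounded by `g` varies by at most `∫ g`. -/
lemma abs_sub_le_setIntegral {f g : ℝ → ℝ} {K : ℝ≥0} (hf : LipschitzWith K f)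
    (hg : IntegrableOn g (Icc (0:ℝ) 1)) (h0 : ∀ t, 0 ≤ g t)
    (hfg : ∀ᵐ t ∂(volume.restrict (Icc (0:ℝ) 1)), |deriv f t| ≤ g t)
    {s : ℝ} (hs : s ∈ Icc (0:ℝ) 1) :
    |f s - f 0| ≤ ∫ t in Icc (0:ℝ) 1, g t := by
  have hsub : Ioc (0:ℝ) s ⊆ Icc 0 1 := fun t ht => ⟨ht.1.le, ht.2.trans hs.2⟩
  have hac : AbsolutelyContinuousOnInterval f 0 s :=
    (hf.lipschitzOnWith (s := uIcc 0 s)).absolutelyContinuousOnInterval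
  rw [← hac.integral_deriv_eq_sub, intervalIntegral.integral_of_le hs.1]
  rw [← Real.norm_eq_abs]
  calc ‖∫ t in Ioc 0 s, deriv f t‖ ≤ ∫ t in Ioc 0 s, g t :=
        norm_integral_le_of_norm_le (hg.mono_set hsub)
          ((ae_restrict_of_ae_restrict_of_subset hsub hfg).mono fun t ht => ht)
    _ ≤ _ := setIntegral_mono_set hg (Filter.Eventually.of_forall h0) hsub.eventuallyLE

lemma norm_sub_le_integral_norm_deriv {n : ℕ} {c : ℝ → E n} {K : ℝ≥0} (hc : LipschitzWith K c)
    {s : ℝ} (hs : s ∈ Icc (0:ℝ) 1) :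
    ‖c s - c 0‖ ≤ ∫ t in Icc (0:ℝ) 1, ‖deriv c t‖ := by
  set v := c s - c 0 with hv
  have hL : 0 ≤ ∫ t in Icc (0:ℝ) 1, ‖deriv c t‖ := integral_nonneg fun t => norm_nonneg _
  have hlip := (innerSL ℝ v).lipschitz.comp hc
  have hmain := abs_sub_le_setIntegral (g := fun t => ‖v‖ * ‖deriv c t‖) hlip
    ((integrableOn_norm_deriv hc).const_mul _) (fun t => by positivity) (by
      filter_upwards [ae_restrict_of_ae hc.ae_differentiableAt_real] with t ht
      have := (innerSL ℝ v).hasFDerivAt.comp_hasDerivAt t ht.hasDerivAt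
      rw [this.deriv]
      exact abs_real_inner_le_norm v (deriv c t)) hs
  rw [integral_const_mul] at hmain
  have e : (innerSL ℝ v ∘ c) s - (innerSL ℝ v ∘ c) 0 = ‖v‖ * ‖v‖ := by
    rw [← real_inner_self_eq_norm_mul_norm]
    exact (inner_sub_right v (c s) (c 0)).symm
  rw [e, abs_of_nonneg (by positivity)] at hmain
  rcases (norm_nonneg v).eq_or_lt with h | h
  · rw [← h]; exact hL
  · exact le_of_mul_le_mul_left hmain h

lemma norm_sub_le_of_mem_horizLengths {n : ℕ} {p q : Heis n} {L : ℝ}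
    (hL : L ∈ horizLengths p q) : ‖q.1 - p.1‖ ≤ L := by
  obtain ⟨c, cb, K, K', hc, -, h0, -, h1, -, -, rfl⟩ := hL
  rw [← h0, ← h1]
  exact norm_sub_le_integral_norm_deriv hc (by simp)

lemma abs_sub_sympL_le_of_mem_horizLengths {n : ℕ} {p q : Heis n} {L : ℝ}
    (hL : L ∈ horizLengths p q) :
    |q.2 - p.2 - (1/2) * sympL n p.1 q.1| ≤ (1/2) * ‖sympL n‖ * L ^ 2 := by
  obtain ⟨c, cb, K, K', hc, hcb, h0, hb0, h1, hb1, hh, rfl⟩ := hL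
  set L := ∫ t in Icc (0:ℝ) 1, ‖deriv c t‖ with hLdef
  have hlip := hcb.sub (((1/2 : ℝ) • sympL n (c 0)).lipschitz.comp hc)
  have hmain := abs_sub_le_setIntegral
    (g := fun t => (1/2) * ‖sympL n‖ * L * ‖deriv c t‖) hlip
    ((integrableOn_norm_deriv hc).const_mul _)
    (fun t => by have := norm_sub_le_integral_norm_deriv hc (s := 0) (by simp); positivity) (by
      filter_upwards [ae_restrict_of_ae hc.ae_differentiableAt_real, hh,
        ae_restrict_mem measurableSet_Icc] with t ht hbt hmem
      have hd := hbt.sub (((1/2 : ℝ) • sympL n (c 0)).hasFDerivAt.comp_hasDerivAt t ht.hasDerivAt)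
      have e : (1/2) * symp (c t) (deriv c t) - ((1/2 : ℝ) • sympL n (c 0)) (deriv c t)
          = (1/2) * sympL n (c t - c 0) (deriv c t) := by
        simp [symp_eq_sympL, mul_sub]
      rw [e] at hd
      rw [show (fun x => cb x - (((1/2 : ℝ) • sympL n (c 0)) ∘ c) x)
        = cb - ((1/2 : ℝ) • sympL n (c 0)) ∘ c from rfl, hd.deriv, abs_mul,
        abs_of_pos (by norm_num : (0:ℝ) < 1/2)]
      have h2 := abs_sympL_le (c t - c 0) (deriv c t)
      have h3 := norm_sub_le_integral_norm_deriv hc hmem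
      calc (1/2) * |sympL n (c t - c 0) (deriv c t)|
          ≤ (1/2) * (‖sympL n‖ * ‖c t - c 0‖ * ‖deriv c t‖) := by gcongr
        _ ≤ (1/2) * (‖sympL n‖ * L * ‖deriv c t‖) := by gcongr
        _ = _ := by ring) (s := 1) (by simp)
  rw [integral_const_mul, ← hLdef] at hmain
  rw [← h0, ← h1, ← hb0, ← hb1]
  convert hmain using 1
  · congr 1
    simp [sympL_self]
    ring
  · ring

/-- A `C¹` horizontal curve on `[0,1]` gives an admissible length, controlled by a bound on
the speed. -/
lemma exists_mem_horizLengths {n : ℕ} {c c' : ℝ → E n} {cb : ℝ → ℝ} {M : ℝ}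
    (hc : ∀ t, HasDerivAt c (c' t) t) (hc' : Continuous c')
    (hcb : ∀ t, HasDerivAt cb ((1/2) * sympL n (c t) (c' t)) t)
    (hM : ∀ t ∈ Icc (0:ℝ) 1, ‖c' t‖ ≤ M) :
    ∃ L ∈ horizLengths (c 0, cb 0) (c 1, cb 1), L ≤ M := by
  have hcc : Continuous c := continuous_iff_continuousAt.2 fun t => (hc t).continuousAt
  have hclamp : LipschitzWith 1 fun t : ℝ => max 0 (min 1 t) :=
    (LipschitzWith.id.const_min 1).const_max 0
  have hmem (t : ℝ) : max 0 (min 1 t) ∈ Icc (0:ℝ) 1 := by simp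
  have hlip {V : Type} [NormedAddCommGroup V] [NormedSpace ℝ V] {f f' : ℝ → V}
      (hf : ∀ t, HasDerivAt f (f' t) t) (hf' : Continuous f') :
      ∃ K : ℝ≥0, LipschitzWith K fun t => f (max 0 (min 1 t)) := by
    obtain ⟨B, hB⟩ := isCompact_Icc.exists_bound_of_continuousOn
      (hf'.continuousOn (s := Icc (0:ℝ) 1))
    have hL : LipschitzOnWith B.toNNReal f (Icc 0 1) :=
      (convex_Icc 0 1).lipschitzOnWith_of_nnnorm_hasDerivWithin_le
        (fun t _ => (hf t).hasDerivWithinAt) fun t ht => by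
          rw [← norm_toNNReal]; exact Real.toNNReal_le_toNNReal (hB t ht)
    exact ⟨B.toNNReal * 1,
      lipschitzOnWith_univ.1 (hL.comp hclamp.lipschitzOnWith fun t _ => hmem t)⟩
  obtain ⟨K, hK⟩ := hlip hc hc'
  obtain ⟨K', hK'⟩ := hlip hcb (by fun_prop)
  have hev {t : ℝ} (ht : t ∈ Ioo (0:ℝ) 1) : (fun s : ℝ => max 0 (min 1 s)) =ᶠ[𝓝 t] id := by
    filter_upwards [isOpen_Ioo.mem_nhds ht] with s hs
    simp [hs.1.le, hs.2.le]
  have hd {t : ℝ} (ht : t ∈ Ioo (0:ℝ) 1) :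
      HasDerivAt (fun s => c (max 0 (min 1 s))) (c' t) t :=
    (hc t).congr_of_eventuallyEq ((hev ht).fun_comp c)
  have hae : ∀ᵐ t ∂(volume.restrict (Icc (0:ℝ) 1)), t ∈ Ioo (0:ℝ) 1 := by
    rw [← restrict_Ioo_eq_restrict_Icc]
    exact ae_restrict_mem measurableSet_Ioo
  refine ⟨_, ⟨fun t => c (max 0 (min 1 t)), fun t => cb (max 0 (min 1 t)), K, K', hK, hK',
    by simp, by simp, by simp, by simp, ?_, rfl⟩, ?_⟩
  · filter_upwards [hae] with t ht
    have h1 : max 0 (min 1 t) = t := (hev ht).eq_of_nhds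
    rw [(hd ht).deriv, h1]
    exact (hcb t).congr_of_eventuallyEq ((hev ht).fun_comp cb)
  · calc ∫ t in Icc (0:ℝ) 1, ‖deriv (fun s => c (max 0 (min 1 s))) t‖
        ≤ ∫ t in Icc (0:ℝ) 1, M := by
          refine integral_mono_ae (integrableOn_norm_deriv hK) (by simp) ?_
          filter_upwards [hae] with t ht
          rw [(hd ht).deriv]
          exact hM t (Ioo_subset_Icc_self ht)
      _ = M := by simp

/-- Horizontal lifts of cubic curves. -/
lemma exists_mem_horizLengths_cubic {n : ℕ} (x : E n) (s : ℝ) (d a b : E n) :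
    ∃ L ∈ horizLengths (x, s) (x + d, s + (1/2) * sympL n x (x + d)
      - (1/6) * sympL n d a - (1/4) * sympL n d b + (1/60) * sympL n a b),
      L ≤ ‖d‖ + ‖a‖ + 2 * ‖b‖ := by
  have hp1 (t : ℝ) : HasDerivAt (fun t : ℝ => t - t ^ 2) (1 - 2 * t) t := by
    simpa using (hasDerivAt_id' t).fun_sub (hasDerivAt_pow 2 t)
  have hp2 (t : ℝ) : HasDerivAt (fun t : ℝ => t - t ^ 3) (1 - 3 * t ^ 2) t := by
    simpa using (hasDerivAt_id' t).fun_sub (hasDerivAt_pow 3 t)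
  have hq1 (t : ℝ) : HasDerivAt (fun t : ℝ => -(1/6) * t ^ 3) (-(1/2) * t ^ 2) t := by
    exact ((hasDerivAt_pow 3 t).const_mul (-(1/6))).congr_deriv (by norm_num; ring)
  have hq2 (t : ℝ) : HasDerivAt (fun t : ℝ => -(1/4) * t ^ 4) (-t ^ 3) t := by
    exact ((hasDerivAt_pow 4 t).const_mul (-(1/4))).congr_deriv (by norm_num; ring)
  have hq3 (t : ℝ) : HasDerivAt (fun t : ℝ => (1/6) * t ^ 3 - (1/4) * t ^ 4 + (1/10) * t ^ 5)
      ((1/2) * t ^ 2 - t ^ 3 + (1/2) * t ^ 4) t := by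
    exact ((((hasDerivAt_pow 3 t).const_mul (1/6)).sub
      ((hasDerivAt_pow 4 t).const_mul (1/4))).add
        ((hasDerivAt_pow 5 t).const_mul (1/10))).congr_deriv (by norm_num; ring)
  let c : ℝ → E n := fun t => x + (t • d + ((t - t ^ 2) • a + (t - t ^ 3) • b))
  let c' : ℝ → E n := fun t => (1:ℝ) • d + ((1 - 2 * t) • a + (1 - 3 * t ^ 2) • b)
  let cb : ℝ → ℝ := fun t => s + ((1/2) * sympL n x (c t) + (-(1/6) * t ^ 3 * sympL n d a
    + (-(1/4) * t ^ 4 * sympL n d b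
      + ((1/6) * t ^ 3 - (1/4) * t ^ 4 + (1/10) * t ^ 5) * sympL n a b)))
  have hc (t : ℝ) : HasDerivAt c (c' t) t :=
    (((hasDerivAt_id t).smul_const d).add
      (((hp1 t).smul_const a).add ((hp2 t).smul_const b))).const_add x
  have hcb (t : ℝ) : HasDerivAt cb ((1/2) * sympL n (c t) (c' t)) t := by
    have h := (((sympL n x).hasFDerivAt.comp_hasDerivAt t (hc t)).const_mul (1/2)).add
      (((hq1 t).mul_const (sympL n d a)).add
        (((hq2 t).mul_const (sympL n d b)).add ((hq3 t).mul_const (sympL n a b)))) |>.const_add s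
    refine h.congr_deriv ?_
    have s1 := sympL_swap a d
    have s2 := sympL_swap b d
    have s3 := sympL_swap b a
    simp only [c, c', map_add, map_smul, smul_eq_mul, add_apply,
      smul_apply, sympL_self, s1, s2, s3]
    ring
  have hM (t : ℝ) (ht : t ∈ Icc (0:ℝ) 1) : ‖c' t‖ ≤ ‖d‖ + ‖a‖ + 2 * ‖b‖ := by
    have h1 : |1 - 2 * t| ≤ 1 := abs_le.2 ⟨by linarith [ht.2], by linarith [ht.1]⟩
    have h2 : |1 - 3 * t ^ 2| ≤ 2 :=
      abs_le.2 ⟨by nlinarith [ht.1, ht.2], by nlinarith [ht.1, ht.2]⟩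
    calc ‖c' t‖ ≤ ‖(1:ℝ) • d‖ + (‖(1 - 2 * t) • a‖ + ‖(1 - 3 * t ^ 2) • b‖) :=
          (norm_add_le _ _).trans (by gcongr; exact norm_add_le _ _)
      _ = ‖d‖ + (|1 - 2 * t| * ‖a‖ + |1 - 3 * t ^ 2| * ‖b‖) := by simp [norm_smul]
      _ ≤ ‖d‖ + (1 * ‖a‖ + 2 * ‖b‖) := by gcongr
      _ = _ := by ring
  have hfin := exists_mem_horizLengths hc (by fun_prop) hcb hM
  have e0 : (c 0, cb 0) = (x, s) := by simp [c, cb, sympL_self]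
  have e1 : (c 1, cb 1) = (x + d, s + (1/2) * sympL n x (x + d)
      - (1/6) * sympL n d a - (1/4) * sympL n d b + (1/60) * sympL n a b) := by
    refine Prod.ext (by simp [c]) ?_
    simp only [cb, c]
    norm_num
    ring
  rwa [e0, e1] at hfin

lemma horizLengths_nonempty {n : ℕ} (hn : 1 ≤ n) (p q : Heis n) : (horizLengths p q).Nonempty := by
  obtain ⟨e, f, hef⟩ := exists_sympL_eq_one hn
  obtain ⟨x, s⟩ := p
  obtain ⟨y, t⟩ := q
  let α := 60 * (1 + (1/4) * sympL n (y - x) f)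
  let β := t - s - (1/2) * sympL n x y + (1/6) * α * sympL n (y - x) e
  obtain ⟨L, hL, -⟩ := exists_mem_horizLengths_cubic x s (y - x) (α • e) (β • f)
  refine ⟨L, ?_⟩
  convert hL using 2
  refine Prod.ext ?_ ?_
  · simp
  · simp only [add_sub_cancel, map_smul, smul_apply, smul_eq_mul, hef]
    have : α * (1/60) = 1 + (1/4) * sympL n (y - x) f := by simp only [α]; ring
    have hβ : β = t - s - (1/2) * sympL n x y + (1/6) * α * sympL n (y - x) e := rfl
    linear_combination (-β) * this - hβ

lemma bddBelow_horizLengths {n : ℕ} (p q : Heis n) : BddBelow (horizLengths p q) :=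
  ⟨0, fun _ => horizLengths_nonneg⟩

lemma ccDist_nonneg {n : ℕ} (p q : Heis n) : 0 ≤ ccDist p q :=
  Real.sInf_nonneg fun _ => horizLengths_nonneg

lemma norm_sub_le_ccDist {n : ℕ} (hn : 1 ≤ n) (p q : Heis n) : ‖q.1 - p.1‖ ≤ ccDist p q :=
  le_csInf (horizLengths_nonempty hn p q) fun _ => norm_sub_le_of_mem_horizLengths

lemma abs_sub_sympL_le_ccDist {n : ℕ} (hn : 1 ≤ n) (p q : Heis n) :
    |q.2 - p.2 - (1/2) * sympL n p.1 q.1| ≤ (1/2) * ‖sympL n‖ * ccDist p q ^ 2 := by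
  have hcl : ccDist p q ∈ closure (horizLengths p q) :=
    csInf_mem_closure (horizLengths_nonempty hn p q) (bddBelow_horizLengths p q)
  have hclosed : IsClosed {L : ℝ | |q.2 - p.2 - (1/2) * sympL n p.1 q.1|
      ≤ (1/2) * ‖sympL n‖ * L ^ 2} := isClosed_le continuous_const (by fun_prop)
  exact closure_minimal (fun L => abs_sub_sympL_le_of_mem_horizLengths) hclosed hcl

lemma ccDist_segment_le {n : ℕ} (x y : E n) (s : ℝ) :
    ccDist (x, s) (y, s + (1/2) * sympL n x y) ≤ ‖y - x‖ := by
  obtain ⟨L, hL, hle⟩ := exists_mem_horizLengths_cubic x s (y - x) 0 0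
  refine (csInf_le (bddBelow_horizLengths _ _) ?_).trans (hle.trans (by simp))
  simpa using hL

lemma ccDist_two_segments_le {n : ℕ} (x y z : E n) (s : ℝ) :
    ccDist (x, s) (z, s + (1/2) * sympL n x y + (1/2) * sympL n y z)
      ≤ ‖z - x‖ + 3 * ‖y - x‖ := by
  obtain ⟨L, hL, hle⟩ := exists_mem_horizLengths_cubic x s (z - x) ((3:ℝ) • (y - x)) 0
  refine (csInf_le (bddBelow_horizLengths _ _) ?_).trans (hle.trans (by simp [norm_smul]))
  convert hL using 2
  refine Prod.ext ?_ ?_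
  · simp
  · have s1 := sympL_swap z x
    have s2 := sympL_swap z y
    simp only [add_sub_cancel, map_smul, map_sub, sub_apply, smul_eq_mul,
      map_zero, sympL_self, s1, s2]
    ring

/-- The local estimates satisfied by a vertical-translation-equivariant map that is locally
Lipschitz for the Carnot–Carathéodory distance. -/
lemma exists_local_bounds {n : ℕ} (hn : 1 ≤ n) {φ : E n → E n} {F : E n → ℝ}
    (hlip : LocLipWith ccDist ccDist (fun p : Heis n => ((φ p.1, p.2 + F p.1) : Heis n)))
    (x : E n) :
    ∃ δ > 0, ∃ K : ℝ≥0, ∃ C : ℝ, LipschitzOnWith K φ (Metric.ball x δ) ∧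
      ∀ y ∈ Metric.ball x δ, ∀ z ∈ Metric.ball x δ,
        |F z - F y - (1/2) * sympL n (φ y) (φ z) + (1/2) * sympL n y z| ≤ C * ‖z - y‖ ^ 2 := by
  obtain ⟨r, hr, K, hK, h⟩ := hlip (x, 0)
  have hmain : ∀ y ∈ Metric.ball x (r / 4), ∀ z ∈ Metric.ball x (r / 4),
      ccDist (φ y, (1/2) * sympL n x y + F y)
        (φ z, (1/2) * sympL n x y + (1/2) * sympL n y z + F z) ≤ K * ‖z - y‖ := by
    intro y hy z hz
    rw [mem_ball_iff_norm] at hy hz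
    have h1 := ccDist_segment_le x y 0
    have h2 := ccDist_two_segments_le x y z 0
    rw [zero_add] at h1 h2
    have h3 := h (y, (1/2) * sympL n x y) (z, (1/2) * sympL n x y + (1/2) * sympL n y z)
      (by linarith) (by linarith)
    exact h3.trans (mul_le_mul_of_nonneg_left (ccDist_segment_le y z _) hK)
  refine ⟨r / 4, by positivity, K.toNNReal, (1/2) * ‖sympL n‖ * K ^ 2, ?_, ?_⟩
  · refine LipschitzOnWith.of_dist_le_mul fun z hz y hy => ?_
    rw [Real.coe_toNNReal K hK, dist_eq_norm, dist_eq_norm]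
    have h1 := norm_sub_le_ccDist hn (φ y, (1/2) * sympL n x y + F y)
      (φ z, (1/2) * sympL n x y + (1/2) * sympL n y z + F z)
    exact h1.trans (hmain y hy z hz)
  · intro y hy z hz
    have h1 := hmain y hy z hz
    have h2 := abs_sub_sympL_le_ccDist hn (φ y, (1/2) * sympL n x y + F y)
      (φ z, (1/2) * sympL n x y + (1/2) * sympL n y z + F z)
    have h3 := ccDist_nonneg (φ y, (1/2) * sympL n x y + F y)
      (φ z, (1/2) * sympL n x y + (1/2) * sympL n y z + F z)
    calc _ = |(1/2) * sympL n x y + (1/2) * sympL n y z + F z - ((1/2) * sympL n x y + F y)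
            - (1/2) * sympL n (φ y) (φ z)| := by congr 1; ring
      _ ≤ _ := h2
      _ ≤ (1/2) * ‖sympL n‖ * (K * ‖z - y‖) ^ 2 := by gcongr
      _ = _ := by ring

lemma exists_lipschitzOnWith_of_quadratic_bound {n : ℕ} {φ : E n → E n} {F : E n → ℝ} {x : E n}
    {C δ : ℝ} {K : ℝ≥0} (hφ : LipschitzOnWith K φ (Metric.ball x δ))
    (hF : ∀ y ∈ Metric.ball x δ, ∀ z ∈ Metric.ball x δ,
      |F z - F y - (1/2) * sympL n (φ y) (φ z) + (1/2) * sympL n y z| ≤ C * ‖z - y‖ ^ 2) :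
    ∃ K' : ℝ≥0, LipschitzOnWith K' F (Metric.ball x δ) := by
  let N := ‖sympL n‖
  let M := (1/2) * N * (‖φ x‖ + K * δ) * K + (1/2) * N * (‖x‖ + δ) + |C| * (2 * δ)
  refine ⟨M.toNNReal, LipschitzOnWith.of_dist_le_mul fun z hz y hy => ?_⟩
  have hK := hφ.dist_le_mul z hz y hy
  have hKx := hφ.dist_le_mul y hy x (Metric.mem_ball_self (Metric.pos_of_mem_ball hy))
  have hFyz := hF y hy z hz
  have s1 := abs_sympL_le (φ y) (φ z - φ y)
  have s2 := abs_sympL_le y (z - y)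
  rw [mem_ball_iff_norm] at hy hz
  have hδ : 0 < δ := (norm_nonneg _).trans_lt hy
  rw [dist_eq_norm, dist_eq_norm] at hK hKx
  have hφy : ‖φ y‖ ≤ ‖φ x‖ + K * δ := by
    have : ‖φ y‖ ≤ ‖φ x‖ + ‖φ y - φ x‖ := by simpa using norm_add_le (φ x) (φ y - φ x)
    have : (K : ℝ) * ‖y - x‖ ≤ K * δ := by gcongr
    linarith
  have hny : ‖y‖ ≤ ‖x‖ + δ := by
    have : ‖y‖ ≤ ‖x‖ + ‖y - x‖ := by simpa using norm_add_le x (y - x)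
    linarith
  have hzy : ‖z - y‖ ≤ 2 * δ := by
    have := norm_sub_le (z - x) (y - x)
    rw [sub_sub_sub_cancel_right] at this
    linarith
  have hM : 0 ≤ M := by positivity
  rw [Real.coe_toNNReal M hM, Real.dist_eq, dist_eq_norm]
  have b1 : |sympL n (φ y) (φ z - φ y)| ≤ N * (‖φ x‖ + K * δ) * (K * ‖z - y‖) :=
    s1.trans (by gcongr)
  have b2 : |sympL n y (z - y)| ≤ N * (‖x‖ + δ) * ‖z - y‖ := s2.trans (by gcongr)
  have b3 : C * ‖z - y‖ ^ 2 ≤ |C| * (2 * δ) * ‖z - y‖ := by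
    calc C * ‖z - y‖ ^ 2 ≤ |C| * ‖z - y‖ ^ 2 := by gcongr; exact le_abs_self C
      _ = |C| * ‖z - y‖ * ‖z - y‖ := by ring
      _ ≤ |C| * (2 * δ) * ‖z - y‖ := by gcongr
  rw [map_sub, sympL_self, sub_zero] at b1 b2
  rw [abs_le] at *
  constructor <;> simp only [M] <;> linarith [b1.1, b1.2, b2.1, b2.2, hFyz.1, hFyz.2]

lemma hasFDerivAt_of_local_quadratic_bound {n : ℕ} {φ : E n → E n} {F : E n → ℝ} {x : E n}
    {C δ : ℝ} (hδ : 0 < δ)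
    (hF : ∀ y ∈ Metric.ball x δ, ∀ z ∈ Metric.ball x δ,
      |F z - F y - (1/2) * sympL n (φ y) (φ z) + (1/2) * sympL n y z| ≤ C * ‖z - y‖ ^ 2)
    {A : E n →L[ℝ] E n} (hA : HasFDerivAt φ A x) :
    HasFDerivAt F ((1/2 : ℝ) • (sympL n (φ x)).comp A - (1/2 : ℝ) • sympL n x) x := by
  have hR : HasFDerivAt (fun z => F z - (1/2) * sympL n (φ x) (φ z) + (1/2) * sympL n x z)
      (0 : E n →L[ℝ] ℝ) x := by
    refine hasFDerivAt_of_quadratic_bound (C := C) ?_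
    filter_upwards [Metric.ball_mem_nhds x hδ] with z hz
    convert hF x (Metric.mem_ball_self hδ) z hz using 2
    simp only [sympL_self, zero_apply]
    ring
  have hS := (((sympL n (φ x)).hasFDerivAt.comp x hA).const_mul (1/2 : ℝ)).sub
    ((sympL n x).hasFDerivAt (x := x) |>.const_mul (1/2 : ℝ))
  have := hR.add hS
  rw [zero_add] at this
  refine this.congr_of_eventuallyEq (Filter.Eventually.of_forall fun z => ?_)
  simp only [Pi.add_apply, Pi.sub_apply, Function.comp_apply]
  ring

lemma LocallyLipschitz.ae_differentiableAt_of_finiteDimensional {V W : Type*}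
    [NormedAddCommGroup V] [NormedSpace ℝ V] [FiniteDimensional ℝ V] [MeasurableSpace V]
    [BorelSpace V] [NormedAddCommGroup W] [NormedSpace ℝ W] [FiniteDimensional ℝ W]
    {μ : Measure V} [μ.IsAddHaarMeasure] {f : V → W} (hf : LocallyLipschitz f) :
    ∀ᵐ x ∂μ, DifferentiableAt ℝ f x := by
  have := FiniteDimensional.proper_real V
  refine measure_null_of_locally_null _ fun x _ => ?_
  obtain ⟨K, t, ht, hK⟩ := hf x
  refine ⟨{y | ¬ DifferentiableAt ℝ f y} ∩ interior t,
    inter_mem_nhdsWithin _ (interior_mem_nhds.2 ht), ?_⟩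
  have h := (hK.mono interior_subset).ae_differentiableWithinAt_of_mem (μ := μ)
  refine measure_mono_null (fun y hy => ?_) (ae_iff.1 h)
  rw [mem_ofPred_eq, Classical.not_imp]
  exact ⟨hy.2, fun hd => hy.1 (hd.differentiableAt (isOpen_interior.mem_nhds hy.2))⟩

/-- A volume preserving homeomorphism `φ̃(x, x̄) = (φ(x), x̄ + F(x))` of `H(n)` which
is locally bi-Lipschitz for the Carnot–Carathéodory distance has `φ` and `F` locally
Lipschitz for the Euclidean distance and, a.e., `φ` is differentiable with symplectic
derivative and `F` is differentiable with `DF(x)y = (1/2)ω(φ(x), Dφ(x)y) − (1/2)ω(x,y)`. -/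
theorem regularity_of_biLipschitz_volume_preserving_homeomorphisms
    (n : ℕ) (hn : 1 ≤ n) (φ : E n → E n) (F : E n → ℝ)
    (hhomeo : IsHomeomorph (fun p : Heis n => ((φ p.1, p.2 + F p.1) : Heis n)))
    (hvol : MeasurePreserving (fun p : Heis n => ((φ p.1, p.2 + F p.1) : Heis n))
      volume volume)
    (hlip : LocLipWith ccDist ccDist
      (fun p : Heis n => ((φ p.1, p.2 + F p.1) : Heis n)))
    (hlipinv : ∃ g : Heis n → Heis n,
      Function.LeftInverse g (fun p : Heis n => ((φ p.1, p.2 + F p.1) : Heis n)) ∧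
      Function.RightInverse g (fun p : Heis n => ((φ p.1, p.2 + F p.1) : Heis n)) ∧
      LocLipWith ccDist ccDist g) :
    LocallyLipschitz φ ∧ LocallyLipschitz F ∧
    ∀ᵐ x : E n,
      ∃ (A : E n →L[ℝ] E n) (ℓ : E n →L[ℝ] ℝ),
        HasFDerivAt φ A x ∧ HasFDerivAt F ℓ x ∧
        (∀ y z : E n, symp (A y) (A z) = symp y z) ∧
        (∀ y : E n, ℓ y = (1/2) * symp (φ x) (A y) - (1/2) * symp x y) := by
  have hloc := exists_local_bounds hn hlip
  have hφ : LocallyLipschitz φ := fun x => by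
    obtain ⟨δ, hδ, K, C, hK, -⟩ := hloc x
    exact ⟨K, _, Metric.ball_mem_nhds x hδ, hK⟩
  refine ⟨hφ, fun x => ?_, ?_⟩
  · obtain ⟨δ, hδ, K, C, hK, hC⟩ := hloc x
    obtain ⟨K', hK'⟩ := exists_lipschitzOnWith_of_quadratic_bound hK hC
    exact ⟨K', _, Metric.ball_mem_nhds x hδ, hK'⟩
  · filter_upwards [hφ.ae_differentiableAt_of_finiteDimensional] with x hx
    obtain ⟨δ, hδ, K, C, -, hC⟩ := hloc x
    exact ⟨_, _, hx.hasFDerivAt, hasFDerivAt_of_local_quadratic_bound hδ hC hx.hasFDerivAt,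
      symplectic_of_quadratic_bound hδ hC hx.hasFDerivAt, fun y => by simp [symp_eq_sympL]⟩
end
end
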